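/- Let E be a regular Courant algebroid identified with F*⊕𝒢⊕F via a dissection, with induced data ∇, R, ℋ, and let ∇^F be a torsion-free connection on F (acting dually on F*). Define ∇^E_{ξ+r+x}(η+s+y) = (∇^F_x η − ⅓ℋ(x,y,−)) + (∇_x s + ⅔[r,s]_𝒢) + ∇^F_x y. Then: (a) ∇^E is an E-connection on E; (b) ∇^E preserves the pseudo-metric: ρ(e₁)⟨e₂,e₃⟩ = ⟨∇^E_{e₁}e₂,e₃⟩ + ⟨e₂,∇^E_{e₁}e₃⟩ for all e₁,e₂,e₃ ∈ Γ(E); (c) ρ(∇^E_{e₁}e₂ − ∇^E_{e₂}e₁) = [ρ(e₁),ρ(e₂)]. -/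

import Mathlib

/-! # Statement 3
On a regular Courant algebroid identified with `F*⊕𝒢⊕F` via a dissection, a
torsion-free connection `∇^F` on `F` and the induced data `∇, R, ℋ` determine an
`E`-connection `∇^E` which preserves the pseudo-metric and whose torsion anchors to
the Lie bracket of vector fields.

Algebraic model: `A` plays the role of `C^∞(M)`, vector fields are
`Derivation ℝ A A`, `F` is a bracket-closed `A`-submodule of `Derivation ℝ A A`,
and the module of sections of `F*⊕𝒢⊕F` is `Module.Dual A F × G × F`. -/

/-- A Courant algebroid (in algebraic form). -/
structure CourantAlgebroid (A : Type) [CommRing A] [Algebra ℝ A]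
    (E : Type) [AddCommGroup E] [Module A E] [Module ℝ E] [IsScalarTower ℝ A E] where
  /-- the pseudo-metric `⟨-,-⟩` -/
  ip : E →ₗ[A] E →ₗ[A] A
  /-- the anchor `ρ` -/
  rho : E →ₗ[A] Derivation ℝ A A
  /-- the Dorfman bracket `∘` (ℝ-bilinear) -/
  dorf : E →ₗ[ℝ] E →ₗ[ℝ] E
  /-- the map `𝒟 : C^∞(M) → Γ(E)` -/
  Dmap : A → E
  ip_symm : ∀ e₁ e₂, ip e₁ e₂ = ip e₂ e₁
  /-- fiberwise nondegeneracy of the pseudo-metric: `Ξ : E → E*` is bijective -/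
  ip_nondeg : Function.Bijective fun e => ip e
  /-- `⟨𝒟f, e⟩ = ½ ρ(e) f` -/
  ip_D : ∀ (f : A) (e : E), (2 : A) * ip (Dmap f) e = rho e f
  /-- `ρ ∘ 𝒟 = 0` -/
  rho_D : ∀ f : A, rho (Dmap f) = 0
  dorf_jacobi : ∀ e₁ e₂ e₃,
    dorf e₁ (dorf e₂ e₃) = dorf (dorf e₁ e₂) e₃ + dorf e₂ (dorf e₁ e₃)
  rho_dorf : ∀ e₁ e₂, rho (dorf e₁ e₂) = ⁅rho e₁, rho e₂⁆
  dorf_leibniz : ∀ (e₁ : E) (f : A) (e₂ : E),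
    dorf e₁ (f • e₂) = rho e₁ f • e₂ + f • dorf e₁ e₂
  dorf_sym : ∀ e₁ e₂, dorf e₁ e₂ + dorf e₂ e₁ = (2 : ℝ) • Dmap (ip e₁ e₂)
  dorf_D : ∀ (f : A) (e : E), dorf (Dmap f) e = 0
  rho_ip : ∀ e₁ e₂ e₃,
    rho e₁ (ip e₂ e₃) = ip (dorf e₁ e₂) e₃ + ip e₂ (dorf e₁ e₃)

namespace CourantAlgebroid

variable {A : Type} [CommRing A] [Algebra ℝ A]
variable {E : Type} [AddCommGroup E] [Module A E] [Module ℝ E] [IsScalarTower ℝ A E]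
variable (ca : CourantAlgebroid A E)

/-- `(ker ρ)⊥`, the subbundle of `E` orthogonal to `ker ρ` w.r.t. the pseudo-metric. -/
def perp : Submodule A E where
  carrier := {e | ∀ k ∈ LinearMap.ker ca.rho, ca.ip e k = 0}
  add_mem' := by
    intro a b ha hb k hk
    simp [map_add, ha k hk, hb k hk]
  zero_mem' := by intro k hk; simp
  smul_mem' := by
    intro c x hx k hk
    simp [map_smul, hx k hk]

/-- Regularity (constant rank of the anchor), expressed by the splitting of the two
canonical short exact sequences `0 → ker ρ → E → F → 0` and
`0 → (ker ρ)⊥ → ker ρ → 𝒢 → 0`. -/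
def IsRegular : Prop :=
  (∃ lam : ↥(LinearMap.range ca.rho) →ₗ[A] E, ∀ x, ca.rho (lam x) = ↑x) ∧
  (∃ sig : (↥(LinearMap.ker ca.rho) ⧸
        (ca.perp.comap (LinearMap.ker ca.rho).subtype)) →ₗ[A] ↥(LinearMap.ker ca.rho),
      ∀ g, (ca.perp.comap (LinearMap.ker ca.rho).subtype).mkQ (sig g) = g)

lemma dorf_mem_ker {r s : E} (hr : r ∈ LinearMap.ker ca.rho)
    (hs : s ∈ LinearMap.ker ca.rho) : ca.dorf r s ∈ LinearMap.ker ca.rho := by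
  rw [LinearMap.mem_ker] at *
  rw [ca.rho_dorf, hr, hs, zero_lie]

lemma dorf_ker_left_mem_ker (e : E) {r : E} (hr : r ∈ LinearMap.ker ca.rho) :
    ca.dorf e r ∈ LinearMap.ker ca.rho := by
  rw [LinearMap.mem_ker] at *
  rw [ca.rho_dorf, hr, lie_zero]

/-- sections of `ker ρ` -/
abbrev Ker := ↥(LinearMap.ker ca.rho)

/-- `(ker ρ)⊥` viewed inside `ker ρ` -/
abbrev perp' : Submodule A ca.Ker := ca.perp.comap (LinearMap.ker ca.rho).subtype

/-- `𝒢 := ker ρ/(ker ρ)⊥` -/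
abbrev Gq := ca.Ker ⧸ ca.perp'

/-- the projection `π : ker ρ → 𝒢` -/
abbrev piG : ca.Ker →ₗ[A] ca.Gq := ca.perp'.mkQ

/-- the ample quotient `𝒜_E := E/(ker ρ)⊥` -/
abbrev Ample := E ⧸ ca.perp

/-- the projection `q : E → 𝒜_E` -/
abbrev qA : E →ₗ[A] ca.Ample := ca.perp.mkQ

/-- Dorfman bracket of two sections of `ker ρ`, viewed in `ker ρ`. -/
def dorfK (r s : ca.Ker) : ca.Ker := ⟨ca.dorf ↑r ↑s, ca.dorf_mem_ker r.2 s.2⟩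

/-- Dorfman bracket of a section of `E` with a section of `ker ρ`, viewed in `ker ρ`. -/
def dorfEK (e : E) (r : ca.Ker) : ca.Ker := ⟨ca.dorf e ↑r, ca.dorf_ker_left_mem_ker e r.2⟩

end CourantAlgebroid

namespace CourantAlgebroid

variable {A : Type} [CommRing A] [Algebra ℝ A]

section General

variable {E : Type} [AddCommGroup E] [Module A E] [Module ℝ E] [IsScalarTower ℝ A E]
variable (ca : CourantAlgebroid A E)

lemma Dmap_zero : ca.Dmap 0 = 0 := by
  apply ca.ip_nondeg.1
  ext e
  have h := ca.ip_D 0 e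
  rw [map_zero, two_mul, ← two_smul ℝ] at h
  simpa using h

lemma dorf_swap {e₁ e₂ : E} (h : ca.ip e₁ e₂ = 0) : ca.dorf e₁ e₂ = -ca.dorf e₂ e₁ := by
  rw [eq_neg_iff_add_eq_zero, ca.dorf_sym, h, Dmap_zero, smul_zero]

/-- On orthogonal sections the Dorfman bracket obeys the Leibniz rule in its first argument. -/
lemma dorf_smul_left {e₁ e₂ : E} (h : ca.ip e₁ e₂ = 0) (f : A) :
    ca.dorf (f • e₁) e₂ = f • ca.dorf e₁ e₂ - ca.rho e₂ f • e₁ := by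
  have h' : ca.ip (f • e₁) e₂ = 0 := by simp [h]
  rw [ca.dorf_swap h', ca.dorf_leibniz, ca.dorf_swap h, smul_neg]
  abel

end General

section Dissection

variable {F : Submodule A (Derivation ℝ A A)}
variable {G : Type} [AddCommGroup G] [Module A G] [Module ℝ G] [IsScalarTower ℝ A G]
variable (ca : CourantAlgebroid A (Module.Dual A F × G × F))

/-- The connection `∇_x s = pr_𝒢 (x ∘ s)` induced by a dissection. -/
def inducedConnection (x : F) (s : G) : G := (ca.dorf (0, 0, x) (0, s, 0)).2.1

/-- The form `ℋ(x, y, -) = pr_{F*} (x ∘ y)` induced by a dissection. -/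
def inducedForm (x y : F) : Module.Dual A F := (ca.dorf (0, 0, x) (0, 0, y)).1

lemma inducedConnection_add_left (x x' : F) (s : G) :
    ca.inducedConnection (x + x') s = ca.inducedConnection x s + ca.inducedConnection x' s := by
  have h : ((0, 0, x + x') : Module.Dual A F × G × F) = (0, 0, x) + (0, 0, x') := by simp
  rw [inducedConnection, h, map_add, LinearMap.add_apply]
  rfl

lemma inducedConnection_add_right (x : F) (s s' : G) :
    ca.inducedConnection x (s + s') = ca.inducedConnection x s + ca.inducedConnection x s' := by
  have h : ((0, s + s', 0) : Module.Dual A F × G × F) = (0, s, 0) + (0, s', 0) := by simp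
  rw [inducedConnection, h, map_add]
  rfl

lemma inducedForm_add_left (x x' y : F) :
    ca.inducedForm (x + x') y = ca.inducedForm x y + ca.inducedForm x' y := by
  have h : ((0, 0, x + x') : Module.Dual A F × G × F) = (0, 0, x) + (0, 0, x') := by simp
  rw [inducedForm, h, map_add, LinearMap.add_apply]
  rfl

lemma inducedForm_add_right (x y y' : F) :
    ca.inducedForm x (y + y') = ca.inducedForm x y + ca.inducedForm x y' := by
  have h : ((0, 0, y + y') : Module.Dual A F × G × F) = (0, 0, y) + (0, 0, y') := by simp
  rw [inducedForm, h, map_add]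
  rfl

lemma inducedForm_smul_right (x : F) (f : A) (y : F) :
    ca.inducedForm x (f • y) = f • ca.inducedForm x y := by
  have h : ((0, 0, f • y) : Module.Dual A F × G × F) = f • (0, 0, y) := by simp
  rw [inducedForm, h, ca.dorf_leibniz]
  simp [inducedForm]

lemma inducedConnection_leibniz (hrho : ∀ p, ca.rho p = ↑p.2.2)
    (x : F) (f : A) (s : G) :
    ca.inducedConnection x (f • s) =
      f • ca.inducedConnection x s + (x : Derivation ℝ A A) f • s := by
  have h : ((0, f • s, 0) : Module.Dual A F × G × F) = f • (0, s, 0) := by simp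
  rw [inducedConnection, h, ca.dorf_leibniz]
  simp [inducedConnection, hrho, add_comm]

lemma inducedConnection_smul_left {ipG : G →ₗ[A] G →ₗ[A] A}
    (hip : ∀ p q, ca.ip p q =
      (2:ℝ)⁻¹ • p.1 q.2.2 + (2:ℝ)⁻¹ • q.1 p.2.2 + ipG p.2.1 q.2.1)
    (f : A) (x : F) (s : G) :
    ca.inducedConnection (f • x) s = f • ca.inducedConnection x s := by
  have h : ((0, 0, f • x) : Module.Dual A F × G × F) = f • (0, 0, x) := by simp
  simp only [inducedConnection, h]
  rw [ca.dorf_smul_left (by simp [hip])]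
  simp

lemma inducedForm_smul_left {ipG : G →ₗ[A] G →ₗ[A] A}
    (hip : ∀ p q, ca.ip p q =
      (2:ℝ)⁻¹ • p.1 q.2.2 + (2:ℝ)⁻¹ • q.1 p.2.2 + ipG p.2.1 q.2.1)
    (f : A) (x y : F) :
    ca.inducedForm (f • x) y = f • ca.inducedForm x y := by
  have h : ((0, 0, f • x) : Module.Dual A F × G × F) = f • (0, 0, x) := by simp
  simp only [inducedForm, h]
  rw [ca.dorf_smul_left (by simp [hip])]
  simp

lemma inducedForm_skew {ipG : G →ₗ[A] G →ₗ[A] A}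
    (hip : ∀ p q, ca.ip p q =
      (2:ℝ)⁻¹ • p.1 q.2.2 + (2:ℝ)⁻¹ • q.1 p.2.2 + ipG p.2.1 q.2.1)
    (x y z : F) :
    ca.inducedForm x y z + ca.inducedForm x z y = 0 := by
  have h := ca.rho_ip (0, 0, x) (0, 0, y) (0, 0, z)
  simp only [hip, LinearMap.zero_apply, smul_zero, map_zero, add_zero, zero_add,
    ← smul_add] at h
  exact (smul_eq_zero.1 h.symm).resolve_left (by norm_num)

/-- The induced connection preserves the metric of `𝒢`. -/
lemma inducedConnection_metric (hrho : ∀ p, ca.rho p = ↑p.2.2)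
    {ipG : G →ₗ[A] G →ₗ[A] A}
    (hip : ∀ p q, ca.ip p q =
      (2:ℝ)⁻¹ • p.1 q.2.2 + (2:ℝ)⁻¹ • q.1 p.2.2 + ipG p.2.1 q.2.1)
    (x : F) (s t : G) :
    (x : Derivation ℝ A A) (ipG s t) =
      ipG (ca.inducedConnection x s) t + ipG s (ca.inducedConnection x t) := by
  simpa [hip, hrho, inducedConnection] using ca.rho_ip (0, 0, x) (0, s, 0) (0, t, 0)

end Dissection

section Connection

variable {F : Submodule A (Derivation ℝ A A)} {nF : F → F → F}

/-- The dual connection on `F*`, `(∇_x η)(z) = x(η z) - η(∇_x z)`. -/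
def dualConnection (nF_add : ∀ x y y', nF x (y + y') = nF x y + nF x y')
    (nF_leibniz : ∀ x (f : A) y, nF x (f • y) = f • nF x y + (x : Derivation ℝ A A) f • y)
    (x : F) (η : Module.Dual A F) : Module.Dual A F where
  toFun z := (x : Derivation ℝ A A) (η z) - η (nF x z)
  map_add' y z := by
    simp only [nF_add, map_add]
    abel
  map_smul' f z := by
    simp only [nF_leibniz, map_add, map_smul, smul_eq_mul, Derivation.leibniz, RingHom.id_apply]
    ring

end Connection

end CourantAlgebroid

open CourantAlgebroid in
/-- The `E`-connection
`∇^E_{ξ+r+x}(η+s+y) = (∇^F_x η − ⅓ℋ(x,y,−)) + (∇_x s + ⅔[r,s]_𝒢) + ∇^F_x y`: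
it is an `E`-connection, it preserves the pseudo-metric, and
`ρ(∇^E_{e₁}e₂ − ∇^E_{e₂}e₁) = [ρ(e₁),ρ(e₂)]`. -/
theorem statement3
    {A : Type} [CommRing A] [Algebra ℝ A]
    (F : Submodule A (Derivation ℝ A A))
    (hF : ∀ x y : ↥F, ⁅(x : Derivation ℝ A A), (y : Derivation ℝ A A)⁆ ∈ F)
    {G : Type} [AddCommGroup G] [Module A G] [Module ℝ G] [IsScalarTower ℝ A G]
    -- 𝒢 is a bundle of quadratic Lie algebras
    (lG : G →ₗ[A] G →ₗ[A] G) (ipG : G →ₗ[A] G →ₗ[A] A)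
    (lG_skew : ∀ r s, lG r s = - lG s r)
    (lG_jacobi : ∀ r s t, lG r (lG s t) = lG (lG r s) t + lG s (lG r t))
    (ipG_symm : ∀ r s, ipG r s = ipG s r)
    (ipG_nondeg : ∀ r, (∀ s, ipG r s = 0) → r = 0)
    (ipG_ad : ∀ r s t, ipG (lG r s) t + ipG s (lG r t) = 0)
    -- a Courant algebroid structure on F*⊕𝒢⊕F obtained from a dissection
    (ca : CourantAlgebroid A (Module.Dual A ↥F × G × ↥F))
    (hrho : ∀ p, ca.rho p = ↑p.2.2)
    (hip : ∀ p q, ca.ip p q =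
      (2:ℝ)⁻¹ • p.1 q.2.2 + (2:ℝ)⁻¹ • q.1 p.2.2 + ipG p.2.1 q.2.1)
    (hG : ∀ r s : G, (ca.dorf (0, r, 0) (0, s, 0)).2.1 = lG r s)
    -- a torsion-free connection ∇^F on F
    (nF : ↥F → ↥F → ↥F)
    (nF_add₁ : ∀ x x' y, nF (x + x') y = nF x y + nF x' y)
    (nF_smul₁ : ∀ (f : A) x y, nF (f • x) y = f • nF x y)
    (nF_add₂ : ∀ x y y', nF x (y + y') = nF x y + nF x y')
    (nF_leibniz : ∀ x (f : A) y, nF x (f • y) = f • nF x y + (x : Derivation ℝ A A) f • y)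
    (nF_torsionfree : ∀ x y, nF x y - nF y x = (⟨⁅(x : Derivation ℝ A A), y⁆, hF x y⟩ : ↥F)) :
    ∃ nE : (Module.Dual A ↥F × G × ↥F) → (Module.Dual A ↥F × G × ↥F) →
        (Module.Dual A ↥F × G × ↥F),
      -- ∇^E is given by the stated formula (componentwise; the F*-component is
      -- characterized by evaluation against sections of F, where
      -- ∇ and ℋ are the data induced by the dissection):
      (∀ p q, (nE p q).2.2 = nF p.2.2 q.2.2) ∧
      (∀ p q, (nE p q).2.1 =
        (ca.dorf (0, 0, p.2.2) (0, q.2.1, 0)).2.1 + (2/3 : ℝ) • lG p.2.1 q.2.1) ∧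
      (∀ p q (z : ↥F), (nE p q).1 z =
        (p.2.2 : Derivation ℝ A A) (q.1 z) - q.1 (nF p.2.2 z)
          - (3:ℝ)⁻¹ • (ca.dorf (0, 0, p.2.2) (0, 0, q.2.2)).1 z) ∧
      -- (a) ∇^E is an E-connection on E
      ((∀ p p' q, nE (p + p') q = nE p q + nE p' q) ∧
       (∀ (f : A) p q, nE (f • p) q = f • nE p q) ∧
       (∀ p q q', nE p (q + q') = nE p q + nE p q') ∧
       (∀ p (f : A) q, nE p (f • q) = f • nE p q + ca.rho p f • q)) ∧
      -- (b) ∇^E preserves the pseudo-metric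
      (∀ e₁ e₂ e₃, ca.rho e₁ (ca.ip e₂ e₃) =
        ca.ip (nE e₁ e₂) e₃ + ca.ip e₂ (nE e₁ e₃)) ∧
      -- (c) ρ(∇^E_{e₁}e₂ − ∇^E_{e₂}e₁) = [ρ(e₁),ρ(e₂)]
      (∀ e₁ e₂, ca.rho (nE e₁ e₂ - nE e₂ e₁) = ⁅ca.rho e₁, ca.rho e₂⁆) := by
  let D := dualConnection nF_add₂ nF_leibniz
  have D_apply : ∀ x η z, D x η z = (x : Derivation ℝ A A) (η z) - η (nF x z) := fun _ _ _ => rfl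
  refine ⟨fun p q => (D p.2.2 q.1 - (3:ℝ)⁻¹ • ca.inducedForm p.2.2 q.2.2,
    ca.inducedConnection p.2.2 q.2.1 + (2/3 : ℝ) • lG p.2.1 q.2.1, nF p.2.2 q.2.2),
    fun _ _ => rfl, fun _ _ => rfl, fun _ _ _ => rfl, ⟨?_, ?_, ?_, ?_⟩, ?_, ?_⟩
  · intro p p' q
    refine Prod.ext (LinearMap.ext fun z => ?_) (Prod.ext ?_ ?_)
    · simp [D_apply, nF_add₁, inducedForm_add_left]
      abel
    · simp [inducedConnection_add_left]
      abel
    · simp [nF_add₁]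
  · intro f p q
    refine Prod.ext (LinearMap.ext fun z => ?_) (Prod.ext ?_ ?_)
    · simp [D_apply, nF_smul₁, ca.inducedForm_smul_left hip, mul_sub]
    · simp [ca.inducedConnection_smul_left hip, smul_comm f (2 / 3 : ℝ)]
    · simp [nF_smul₁]
  · intro p q q'
    refine Prod.ext (LinearMap.ext fun z => ?_) (Prod.ext ?_ ?_)
    · simp [D_apply, inducedForm_add_right]
      abel
    · simp [inducedConnection_add_right]
      abel
    · simp [nF_add₂]
  · intro p f q
    refine Prod.ext (LinearMap.ext fun z => ?_) (Prod.ext ?_ ?_)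
    · simp [D_apply, inducedForm_smul_right, hrho, mul_sub]
      ring
    · simp [ca.inducedConnection_leibniz hrho, hrho, smul_comm f (2 / 3 : ℝ)]
      abel
    · simp [nF_leibniz, hrho]
  · intro e₁ e₂ e₃
    have hH := congrArg ((2:ℝ)⁻¹ • (3:ℝ)⁻¹ • ·)
      (ca.inducedForm_skew hip e₁.2.2 e₂.2.2 e₃.2.2)
    have hN := ca.inducedConnection_metric hrho hip e₁.2.2 e₂.2.1 e₃.2.1
    have hL := congrArg ((2/3 : ℝ) • ·) (ipG_ad e₁.2.1 e₂.2.1 e₃.2.1)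
    simp only [smul_add, smul_zero] at hH hL
    simp only [hip, hrho, map_add, hN, LinearMap.add_apply, LinearMap.sub_apply,
      LinearMap.smul_apply, D_apply, LinearMap.map_smul_of_tower, Derivation.map_smul, smul_sub]
    linear_combination hH - hL
  · intro e₁ e₂
    rw [hrho, hrho, hrho]
    exact congrArg Subtype.val (nF_torsionfree e₁.2.2 e₂.2.2)
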